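/- arXiv:1509.04971 — 3 statements merged into one kernel-verified Lean document; each statement's English description precedes it below -/
import Mathlib

section
/- Let α∈ℝ, and let N>0 and L>0 be such that (r_+⁴ − a²ℓ²)/(r_+²+a²)² < −N. Then there exist δ>0, R₁>r_+ and m₀∈ℕ such that for every m∈ℤ with |m| ≥ m₀ and every λ∈ℝ with λ ≤ (1+δ)Ξ²m², the radial potential V built from (m, ω_+, α, λ) satisfies V(r) − ω_+² ≤ −N·Δ_-(r)·m²Ξ²/(r²+a²)² for all r∈[R₁, R₁+L]. -/
open Set

/-- The part of the radial potential that does not grow with `m`, relative to `Δ / (r² + a²)²`,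
is dominated by `m²`, uniformly on a compact interval. -/
lemma exists_nat_forall_lowerOrder_le (ℓ M a β t : ℝ) {κ A B : ℝ} (hκ : 0 < κ) (hA : 0 < A) :
    ∃ m₀ : ℕ, ∀ m : ℤ, (m₀ : ℤ) ≤ |m| → ∀ r ∈ Icc A B,
      (5 * r ^ 4 / ℓ ^ 2 + 3 * r ^ 2 * (1 + a ^ 2 / ℓ ^ 2) - 4 * M * r + a ^ 2) / (r ^ 2 + a ^ 2)
        - β * (r ^ 2 + t * a ^ 2) ≤ κ * (m : ℝ) ^ 2 := by
  have hcont : ContinuousOn (fun r : ℝ =>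
      (5 * r ^ 4 / ℓ ^ 2 + 3 * r ^ 2 * (1 + a ^ 2 / ℓ ^ 2) - 4 * M * r + a ^ 2) / (r ^ 2 + a ^ 2)
        - β * (r ^ 2 + t * a ^ 2)) (Icc A B) := by
    refine ContinuousOn.sub (ContinuousOn.div (by fun_prop) (by fun_prop) ?_) (by fun_prop)
    intro r hr
    have : 0 < r := hA.trans_le hr.1
    positivity
  obtain ⟨C, hC⟩ := isCompact_Icc.bddAbove_image hcont
  obtain ⟨n, hn⟩ := exists_nat_ge (C / κ)
  refine ⟨n, fun m hm r hr => (hC (mem_image_of_mem _ hr)).trans ?_⟩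
  have h1 : (n : ℤ) ≤ m ^ 2 := by
    rw [← sq_abs]
    nlinarith [Int.le_self_sq |m|]
  have h2 : (n : ℝ) ≤ (m : ℝ) ^ 2 := by exact_mod_cast h1
  rw [mul_comm]
  exact (div_le_iff₀ hκ).1 (hn.trans h2)

/-- Far out, `Δ` is nonnegative and `a² (r² - r₊²)²` exceeds `(a² ℓ² - k) Δ`. -/
lemma exists_forall_ge_le_sq_sub_sq {ℓ M k : ℝ} (a rp : ℝ) (hℓ : 0 < ℓ) (hM : 0 < M)
    (hrp : 0 < rp) (hk : 0 < k) :
    ∃ R > rp, ∀ r ≥ R, 0 ≤ (r ^ 2 + a ^ 2) * (1 + r ^ 2 / ℓ ^ 2) - 2 * M * r ∧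
      (a ^ 2 * ℓ ^ 2 - k) * ((r ^ 2 + a ^ 2) * (1 + r ^ 2 / ℓ ^ 2) - 2 * M * r)
        ≤ a ^ 2 * (r ^ 2 - rp ^ 2) ^ 2 := by
  set T : ℝ := ℓ ^ 2 * (a ^ 2 * (a ^ 2 + ℓ ^ 2 + 2 * rp ^ 2 + a ^ 2 * ℓ ^ 2)) / k with hT
  have hT0 : 0 ≤ T := by positivity
  refine ⟨1 + rp + 2 * M + T, by linarith, fun r hr => ?_⟩
  have hr1 : 1 ≤ r := by linarith
  have hr2 : 2 * M ≤ r := by linarith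
  have hrT : T ≤ r ^ 2 := by nlinarith
  set D : ℝ := (r ^ 2 + a ^ 2) * (1 + r ^ 2 / ℓ ^ 2) - 2 * M * r with hD
  have hlower : r ^ 4 / ℓ ^ 2 ≤ D := by
    have e : D = r ^ 4 / ℓ ^ 2 + r * (r - 2 * M) + a ^ 2 + a ^ 2 * (r ^ 2 / ℓ ^ 2) := by
      rw [hD]; ring
    have : 0 ≤ r * (r - 2 * M) := mul_nonneg (by linarith) (by linarith)
    have : 0 ≤ a ^ 2 * (r ^ 2 / ℓ ^ 2) := by positivity
    nlinarith [sq_nonneg a]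
  refine ⟨le_trans (by positivity) hlower, ?_⟩
  have hupper : ℓ ^ 2 * D - (r ^ 2 - rp ^ 2) ^ 2
      ≤ (a ^ 2 + ℓ ^ 2 + 2 * rp ^ 2 + a ^ 2 * ℓ ^ 2) * r ^ 2 := by
    have e : ℓ ^ 2 * D = (r ^ 2 + a ^ 2) * (ℓ ^ 2 + r ^ 2) - ℓ ^ 2 * (2 * M * r) := by
      rw [hD]; field_simp
    have h1 : 0 ≤ ℓ ^ 2 * (2 * M * r) := by positivity
    have h2 : 0 ≤ a ^ 2 * ℓ ^ 2 * (r ^ 2 - 1) :=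
      mul_nonneg (by positivity) (by nlinarith)
    nlinarith [sq_nonneg (rp ^ 2)]
  have hgrow : a ^ 2 * (a ^ 2 + ℓ ^ 2 + 2 * rp ^ 2 + a ^ 2 * ℓ ^ 2) * r ^ 2
      ≤ k * (r ^ 4 / ℓ ^ 2) := by
    have h1 : ℓ ^ 2 * (a ^ 2 * (a ^ 2 + ℓ ^ 2 + 2 * rp ^ 2 + a ^ 2 * ℓ ^ 2)) ≤ r ^ 2 * k :=
      (div_le_iff₀ hk).1 hrT
    rw [← mul_div_assoc, le_div_iff₀ (by positivity)]
    nlinarith [mul_le_mul_of_nonneg_right h1 (sq_nonneg r)]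
  nlinarith [mul_le_mul_of_nonneg_left hupper (sq_nonneg a),
    mul_le_mul_of_nonneg_left hlower hk.le]

theorem stmt_8 (ℓ M a rp : ℝ) (hℓ : 0 < ℓ) (hM : 0 < M) (ha : |a| < ℓ) (hrp : 0 < rp)
    (Δ : ℝ → ℝ) (hΔ : ∀ r, Δ r = (r ^ 2 + a ^ 2) * (1 + r ^ 2 / ℓ ^ 2) - 2 * M * r)
    (hroot : Δ rp = 0) (hmax : ∀ r, Δ r = 0 → r ≤ rp) (hd : 0 < deriv Δ rp)
    (Ξ : ℝ) (hΞ : Ξ = 1 - a ^ 2 / ℓ ^ 2)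
    (α N L : ℝ) (hN : 0 < N) (hL : 0 < L)
    (hHR : (rp ^ 4 - a ^ 2 * ℓ ^ 2) / (rp ^ 2 + a ^ 2) ^ 2 < -N) :
    ∃ δ > (0:ℝ), ∃ R₁ > rp, ∃ m₀ : ℕ, ∀ m : ℤ, (m₀ : ℤ) ≤ |m| →
      ∀ lam : ℝ, lam ≤ (1 + δ) * Ξ ^ 2 * (m : ℝ) ^ 2 →
      ∀ r ∈ Icc R₁ (R₁ + L),
        ((-3) * r ^ 2 * (Δ r) ^ 2 / (r ^ 2 + a ^ 2) ^ 4
            + Δ r * (5 * r ^ 4 / ℓ ^ 2 + 3 * r ^ 2 * (1 + a ^ 2 / ℓ ^ 2) - 4 * M * r + a ^ 2)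
              / (r ^ 2 + a ^ 2) ^ 3)
        + ((Δ r * (lam + ((m : ℝ) * a * Ξ / (rp ^ 2 + a ^ 2)) ^ 2 * a ^ 2)
            - Ξ ^ 2 * a ^ 2 * (m : ℝ) ^ 2
            - 2 * (m : ℝ) * ((m : ℝ) * a * Ξ / (rp ^ 2 + a ^ 2)) * a * Ξ * (Δ r - (r ^ 2 + a ^ 2)))
              / (r ^ 2 + a ^ 2) ^ 2)
        + (-(α / ℓ ^ 2) * Δ r * (r ^ 2 + (if 0 < α then 1 else 0) * a ^ 2) / (r ^ 2 + a ^ 2) ^ 2)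
        - ((m : ℝ) * a * Ξ / (rp ^ 2 + a ^ 2)) ^ 2
        ≤ -N * Δ r * (m : ℝ) ^ 2 * Ξ ^ 2 / (r ^ 2 + a ^ 2) ^ 2 := by
  have hp : 0 < rp ^ 2 + a ^ 2 := by positivity
  have hΞ0 : 0 < Ξ := by
    rw [hΞ, sub_pos, div_lt_one (by positivity)]
    exact sq_lt_sq.2 (by rwa [abs_of_pos hℓ])
  obtain ⟨c, hc⟩ : ∃ c, c = -N - (rp ^ 4 - a ^ 2 * ℓ ^ 2) / (rp ^ 2 + a ^ 2) ^ 2 := ⟨_, rfl⟩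
  have hc0 : 0 < c := by linarith
  obtain ⟨R, hR, hfar⟩ := exists_forall_ge_le_sq_sub_sq (k := (rp ^ 2 + a ^ 2) ^ 2 * (c / 4))
    a rp hℓ hM hrp (by positivity)
  obtain ⟨m₀, hm₀⟩ := exists_nat_forall_lowerOrder_le ℓ M a (α / ℓ ^ 2) (if 0 < α then 1 else 0)
    (κ := c / 2 * Ξ ^ 2) (A := R) (B := R + L) (by positivity) (hrp.trans hR)
  refine ⟨c / 4, by positivity, R, hR, m₀, fun m hm lam hlam r hr => ?_⟩
  have hlow := hm₀ m hm r hr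
  obtain ⟨hD, hgap⟩ := hfar r hr.1
  rw [← hΔ r] at hD hgap
  have hx : 0 < r ^ 2 + a ^ 2 := by
    have := (hrp.trans hR).trans_le hr.1
    positivity
  generalize (if 0 < α then (1 : ℝ) else 0) = t at *
  generalize Δ r = D at *
  set h : ℝ := (5 * r ^ 4 / ℓ ^ 2 + 3 * r ^ 2 * (1 + a ^ 2 / ℓ ^ 2) - 4 * M * r + a ^ 2)
    / (r ^ 2 + a ^ 2) - α / ℓ ^ 2 * (r ^ 2 + t * a ^ 2) with hh
  set q : ℝ := D * (c / 4 + rp ^ 4 / (rp ^ 2 + a ^ 2) ^ 2)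
    - a ^ 2 * (r ^ 2 - rp ^ 2) ^ 2 / (rp ^ 2 + a ^ 2) ^ 2 + N * D with hq
  have hq_le : q ≤ -(c / 2) * D := by
    have h1 : (a ^ 2 * ℓ ^ 2 / (rp ^ 2 + a ^ 2) ^ 2 - c / 4) * D
        ≤ a ^ 2 * (r ^ 2 - rp ^ 2) ^ 2 / (rp ^ 2 + a ^ 2) ^ 2 := by
      rw [le_div_iff₀ (by positivity)]
      refine le_of_eq_of_le ?_ hgap
      field_simp
    have h2 : rp ^ 4 / (rp ^ 2 + a ^ 2) ^ 2 - a ^ 2 * ℓ ^ 2 / (rp ^ 2 + a ^ 2) ^ 2 = -N - c := by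
      rw [hc, sub_div]; ring
    have h3 : rp ^ 4 / (rp ^ 2 + a ^ 2) ^ 2 = a ^ 2 * ℓ ^ 2 / (rp ^ 2 + a ^ 2) ^ 2 - N - c := by
      linarith
    rw [hq, h3]
    linarith
  have hmain : D * h + D * (lam - (1 + c / 4) * Ξ ^ 2 * (m : ℝ) ^ 2) + Ξ ^ 2 * (m : ℝ) ^ 2 * q
      ≤ 0 := by
    have h1 := mul_le_mul_of_nonneg_left hlow hD
    have h2 : D * (lam - (1 + c / 4) * Ξ ^ 2 * (m : ℝ) ^ 2) ≤ 0 :=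
      mul_nonpos_of_nonneg_of_nonpos hD (by linarith)
    have h3 := mul_le_mul_of_nonneg_left hq_le (by positivity : 0 ≤ Ξ ^ 2 * (m : ℝ) ^ 2)
    linarith
  have hsq : 0 ≤ 3 * r ^ 2 * D ^ 2 / (r ^ 2 + a ^ 2) ^ 4 := by positivity
  have hdiv := div_nonpos_of_nonpos_of_nonneg hmain (sq_nonneg (r ^ 2 + a ^ 2))
  rw [← sub_nonpos]
  refine le_of_eq_of_le ?_ (add_nonpos (neg_nonpos.2 hsq) hdiv)
  rw [hh, hq]
  clear_value h q
  field_simp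
  ring
end

section
/- Let r_+ < R₁ < R₂ < ∞, L := R₂−R₁, N>0, m∈ℤ and ω∈ℝ, and let V:(r_+,∞)→ℝ be continuous with V(r) − ω² ≤ −N·Δ_-(r)·m²Ξ²/(r²+a²)² for all r∈(R₁,R₂). If moreover N·m²Ξ²·L² > 128·Δ_-(R₂)·(R₂²+a²)/(r_+²+a²), then there exists a smooth real-valued function f, compactly supported in (R₁,R₂) and not identically zero, such that ∫_{r_+}^∞ ( (Δ_-(r)/(r²+a²))·f'(r)² + (V(r)−ω²)·((r²+a²)/Δ_-(r))·f(r)² ) dr < 0. -/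
open Set MeasureTheory

/-- A smooth regularisation of `t ↦ max t 0` with slope in `[0, 1]`. -/
theorem exists_smooth_posPart {δ : ℝ} (hδ : 0 < δ) :
    ∃ φ S : ℝ → ℝ, ContDiff ℝ (⊤ : ℕ∞) φ ∧ (∀ t, HasDerivAt φ (S t) t) ∧
      (∀ t, 0 ≤ S t ∧ S t ≤ 1) ∧ (∀ t ≤ δ, φ t = 0) ∧ ∀ t, 2 * δ ≤ t → t - 2 * δ ≤ φ t := by
  set S : ℝ → ℝ := fun t => Real.smoothTransition (t / δ - 1) with hS
  have hSsmooth : ContDiff ℝ (⊤ : ℕ∞) S :=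
    Real.smoothTransition.contDiff.comp ((contDiff_id.div_const δ).sub contDiff_const)
  have hSc : Continuous S := hSsmooth.continuous
  have hS0 : ∀ t ≤ δ, S t = 0 := fun t ht =>
    Real.smoothTransition.zero_of_nonpos (by rw [sub_nonpos, div_le_one hδ]; exact ht)
  have hS1 : ∀ t, 2 * δ ≤ t → S t = 1 := fun t ht =>
    Real.smoothTransition.one_of_one_le (by rw [le_sub_iff_add_le, le_div_iff₀ hδ]; linarith)
  have hderiv : ∀ t, HasDerivAt (fun t => ∫ s in δ..t, S s) (S t) t := fun t =>
    intervalIntegral.integral_hasDerivAt_right (hSc.intervalIntegrable _ _)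
      hSc.stronglyMeasurable.stronglyMeasurableAtFilter hSc.continuousAt
  refine ⟨fun t => ∫ s in δ..t, S s, S, ?_, hderiv,
    fun t => ⟨Real.smoothTransition.nonneg _, Real.smoothTransition.le_one _⟩, ?_, ?_⟩
  · rw [contDiff_infty_iff_deriv]
    refine ⟨fun t => (hderiv t).differentiableAt, ?_⟩
    rwa [funext fun t => (hderiv t).deriv]
  · intro t ht
    refine intervalIntegral.integral_zero_ae (Filter.Eventually.of_forall fun s hs => hS0 s ?_)
    rw [uIoc_of_ge ht] at hs
    exact hs.2
  · intro t ht
    have hsplit := intervalIntegral.integral_add_adjacent_intervals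
      (hSc.intervalIntegrable (μ := volume) δ (2 * δ)) (hSc.intervalIntegrable (2 * δ) t)
    have hnonneg : 0 ≤ ∫ s in δ..(2 * δ), S s :=
      intervalIntegral.integral_nonneg (by linarith) fun s _ => Real.smoothTransition.nonneg _
    have hone : ∫ s in (2 * δ)..t, S s = t - 2 * δ := by
      rw [intervalIntegral.integral_congr (g := fun _ => (1 : ℝ))]
      · simp
      · intro s hs
        rw [uIcc_of_le ht] at hs
        exact hS1 s hs.1
    change t - 2 * δ ≤ ∫ s in δ..t, S s
    linarith

/-- A smooth bump on `(R₁, R₂)` with controlled slope and height on the middle half. -/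
theorem exists_smooth_bump_deriv_le {R₁ R₂ : ℝ} (h : R₁ < R₂) :
    ∃ f : ℝ → ℝ, ContDiff ℝ (⊤ : ℕ∞) f ∧ HasCompactSupport f ∧ tsupport f ⊆ Ioo R₁ R₂ ∧
      (∀ r ∈ Ioo R₁ R₂, deriv f r ^ 2 ≤ (R₂ - R₁) ^ 2) ∧
      ∀ r ∈ Icc (R₁ + (R₂ - R₁) / 4) (R₂ - (R₂ - R₁) / 4),
        5 / 32 * (R₂ - R₁) ^ 2 ≤ f r := by
  have hL : 0 < (R₂ - R₁) ^ 2 := pow_pos (sub_pos.2 h) 2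
  obtain ⟨φ, S, hφ, hφd, hS, hφ0, hφ1⟩ :=
    exists_smooth_posPart (δ := (R₂ - R₁) ^ 2 / 64) (by positivity)
  have hw : ContDiff ℝ (⊤ : ℕ∞) fun r : ℝ => (r - R₁) * (R₂ - r) := by fun_prop
  have hsub : tsupport (fun r => φ ((r - R₁) * (R₂ - r))) ⊆ Ioo R₁ R₂ := by
    have hclosed : IsClosed {r : ℝ | (R₂ - R₁) ^ 2 / 64 ≤ (r - R₁) * (R₂ - r)} :=
      isClosed_le continuous_const hw.continuous
    refine (closure_minimal (fun r hr => ?_) hclosed).trans fun r hr => ?_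
    · by_contra hlt
      exact hr (hφ0 _ (not_le.1 hlt).le)
    · have hpos : 0 < (r - R₁) * (R₂ - r) := lt_of_lt_of_le (by positivity) hr
      rcases mul_pos_iff.1 hpos with h' | h'
      · exact ⟨by linarith [h'.1], by linarith [h'.2]⟩
      · linarith [h'.1, h'.2]
  refine ⟨fun r => φ ((r - R₁) * (R₂ - r)), hφ.comp hw, ?_, hsub, ?_, ?_⟩
  · exact isCompact_Icc.of_isClosed_subset (isClosed_tsupport _) (hsub.trans Ioo_subset_Icc_self)
  · intro r hr
    have hwd : HasDerivAt (fun r : ℝ => (r - R₁) * (R₂ - r)) (R₁ + R₂ - 2 * r) r := by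
      refine (((hasDerivAt_id' r).sub_const R₁).mul
        ((hasDerivAt_id' r).const_sub R₂)).congr_deriv ?_
      ring
    have hfd : deriv (fun r => φ ((r - R₁) * (R₂ - r))) r = _ := ((hφd _).comp r hwd).deriv
    rw [hfd, mul_pow]
    obtain ⟨h0, h1⟩ := hS ((r - R₁) * (R₂ - r))
    have hsq : S ((r - R₁) * (R₂ - r)) ^ 2 ≤ 1 := pow_le_one₀ h0 h1
    have hsl : (R₁ + R₂ - 2 * r) ^ 2 ≤ (R₂ - R₁) ^ 2 :=
      sq_le_sq' (by linarith [hr.2]) (by linarith [hr.1])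
    nlinarith [sq_nonneg (R₁ + R₂ - 2 * r)]
  · intro r hr
    have hw' : 3 / 16 * (R₂ - R₁) ^ 2 ≤ (r - R₁) * (R₂ - r) := by
      nlinarith [mul_nonneg (sub_nonneg.2 hr.1) (sub_nonneg.2 hr.2)]
    have := hφ1 ((r - R₁) * (R₂ - r)) (by linarith)
    change _ ≤ φ _
    linarith

theorem quartic_strictMonoOn {k c b d rp : ℝ} (hk : 0 ≤ k) (hc : 0 ≤ c) (hrp : 0 < rp)
    (hd : 0 < 4 * k * rp ^ 3 + 2 * c * rp - b) :
    StrictMonoOn (fun r : ℝ => k * r ^ 4 + c * r ^ 2 - b * r + d) (Ici rp) := by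
  intro r hr s hs hrs
  have hr' : rp ≤ r := hr
  have hs' : rp ≤ s := hs
  have hcube : (rp + rp) * (rp ^ 2 + rp ^ 2) ≤ (s + r) * (s ^ 2 + r ^ 2) := by
    have : 0 ≤ s + r := by linarith
    gcongr
  have hslope : 0 < k * ((s + r) * (s ^ 2 + r ^ 2)) + c * (s + r) - b := by
    nlinarith [mul_le_mul_of_nonneg_left hcube hk,
      mul_le_mul_of_nonneg_left (add_le_add hs' hr') hc]
  have := mul_pos (sub_pos.2 hrs) hslope
  change k * r ^ 4 + c * r ^ 2 - b * r + d < k * s ^ 4 + c * s ^ 2 - b * s + d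
  linarith

theorem stmt_9 (ℓ M a rp : ℝ) (hℓ : 0 < ℓ) (hM : 0 < M) (ha : |a| < ℓ) (hrp : 0 < rp)
    (Δ : ℝ → ℝ) (hΔ : ∀ r, Δ r = (r ^ 2 + a ^ 2) * (1 + r ^ 2 / ℓ ^ 2) - 2 * M * r)
    (hroot : Δ rp = 0) (hmax : ∀ r, Δ r = 0 → r ≤ rp) (hd : 0 < deriv Δ rp)
    (Ξ : ℝ) (hΞ : Ξ = 1 - a ^ 2 / ℓ ^ 2)
    (R₁ R₂ L N : ℝ) (hR₁ : rp < R₁) (hR₂ : R₁ < R₂) (hLdef : L = R₂ - R₁) (hN : 0 < N)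
    (m : ℤ) (ω : ℝ) (V : ℝ → ℝ) (hVcont : ContinuousOn V (Ioi rp))
    (hVneg : ∀ r ∈ Ioo R₁ R₂, V r - ω ^ 2 ≤ -N * Δ r * (m : ℝ) ^ 2 * Ξ ^ 2 / (r ^ 2 + a ^ 2) ^ 2)
    (hquant : N * (m : ℝ) ^ 2 * Ξ ^ 2 * L ^ 2 >
      128 * Δ R₂ * (R₂ ^ 2 + a ^ 2) / (rp ^ 2 + a ^ 2)) :
    ∃ f : ℝ → ℝ, ContDiff ℝ (⊤ : ℕ∞) f ∧ HasCompactSupport f ∧ tsupport f ⊆ Ioo R₁ R₂ ∧ f ≠ 0 ∧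
      (∫ r in Ioi rp,
        (Δ r / (r ^ 2 + a ^ 2) * (deriv f r) ^ 2
          + (V r - ω ^ 2) * ((r ^ 2 + a ^ 2) / Δ r) * (f r) ^ 2)) < 0 := by
  have hLpos : 0 < L := by linarith
  have hquartic : Δ = fun r : ℝ =>
      1 / ℓ ^ 2 * r ^ 4 + (1 + a ^ 2 / ℓ ^ 2) * r ^ 2 - 2 * M * r + a ^ 2 := by
    funext r
    rw [hΔ]
    ring
  have hmono : StrictMonoOn Δ (Ici rp) := by
    have hderiv : HasDerivAt Δ
        (4 * (1 / ℓ ^ 2) * rp ^ 3 + 2 * (1 + a ^ 2 / ℓ ^ 2) * rp - 2 * M) rp := by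
      rw [hquartic]
      refine ((((((hasDerivAt_id' rp).pow 4).const_mul (1 / ℓ ^ 2)).add
        (((hasDerivAt_id' rp).pow 2).const_mul (1 + a ^ 2 / ℓ ^ 2))).sub
        ((hasDerivAt_id' rp).const_mul (2 * M))).add_const (a ^ 2)).congr_deriv ?_
      norm_num
      ring
    rw [hderiv.deriv] at hd
    rw [hquartic]
    exact quartic_strictMonoOn (by positivity) (by positivity) hrp hd
  have hΔpos : ∀ r, rp < r → 0 < Δ r := fun r hr => by
    simpa [hroot] using hmono self_mem_Ici hr.le hr
  have hΔcont : Continuous Δ := by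
    rw [hquartic]
    fun_prop
  obtain ⟨f, hf, hfc, hfs, hfd, hfl⟩ := exists_smooth_bump_deriv_le hR₂
  rw [← hLdef] at hfd hfl
  refine ⟨f, hf, hfc, hfs, ?_, ?_⟩
  · intro h0
    have := hfl ((R₁ + R₂) / 2) ⟨by linarith, by linarith⟩
    rw [h0] at this
    have : 0 < 5 / 32 * L ^ 2 := by positivity
    simp only [Pi.zero_apply] at *
    linarith
  set g : ℝ → ℝ := fun r => Δ r / (r ^ 2 + a ^ 2) * (deriv f r) ^ 2
    + (V r - ω ^ 2) * ((r ^ 2 + a ^ 2) / Δ r) * (f r) ^ 2 with hg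
  set K₁ := Δ R₂ / (rp ^ 2 + a ^ 2) with hK₁
  set K₂ := N * (m : ℝ) ^ 2 * Ξ ^ 2 / (R₂ ^ 2 + a ^ 2) with hK₂
  have hK₁pos : 0 < K₁ := div_pos (hΔpos R₂ (by linarith)) (by positivity)
  have hK₂nonneg : 0 ≤ K₂ := by positivity
  have hK : 128 * K₁ < K₂ * L ^ 2 := by
    have hR₂pos : 0 < R₂ ^ 2 + a ^ 2 := add_pos_of_pos_of_nonneg
      (pow_pos (by linarith) 2) (sq_nonneg a)
    rw [hK₂, div_mul_eq_mul_div, lt_div_iff₀ hR₂pos]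
    calc 128 * K₁ * (R₂ ^ 2 + a ^ 2)
        = 128 * Δ R₂ * (R₂ ^ 2 + a ^ 2) / (rp ^ 2 + a ^ 2) := by rw [hK₁]; ring
      _ < _ := hquant
  have hbound : ∀ r ∈ Ioo R₁ R₂, g r ≤ K₁ * L ^ 2 - K₂ * f r ^ 2 := by
    intro r hr
    have hrpr : rp < r := hR₁.trans hr.1
    have hr0 : 0 < r := hrp.trans hrpr
    have hΔr := hΔpos r hrpr
    have hq : 0 < r ^ 2 + a ^ 2 := by positivity
    have hkin : Δ r / (r ^ 2 + a ^ 2) ≤ K₁ := by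
      have : Δ r ≤ Δ R₂ := (hmono hrpr.le (hrpr.trans hr.2).le hr.2).le
      have : 0 ≤ Δ R₂ := (hΔpos R₂ (by linarith)).le
      rw [hK₁]
      gcongr
    have hpot : (V r - ω ^ 2) * ((r ^ 2 + a ^ 2) / Δ r) ≤ -K₂ := by
      calc (V r - ω ^ 2) * ((r ^ 2 + a ^ 2) / Δ r)
          ≤ -N * Δ r * (m : ℝ) ^ 2 * Ξ ^ 2 / (r ^ 2 + a ^ 2) ^ 2 * ((r ^ 2 + a ^ 2) / Δ r) :=
            mul_le_mul_of_nonneg_right (hVneg r hr) (by positivity)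
        _ = -(N * (m : ℝ) ^ 2 * Ξ ^ 2 / (r ^ 2 + a ^ 2)) := by field_simp
        _ ≤ -K₂ := by
            have := hr.2.le
            rw [hK₂]
            gcongr
    have h1 : Δ r / (r ^ 2 + a ^ 2) * (deriv f r) ^ 2 ≤ K₁ * L ^ 2 :=
      mul_le_mul hkin (hfd r hr) (sq_nonneg _) hK₁pos.le
    have h2 := mul_le_mul_of_nonneg_right hpot (sq_nonneg (f r))
    change _ + _ ≤ _
    linarith
  have hgcont : ContinuousOn g (Icc R₁ R₂) := by
    have hd' : Continuous (deriv f) := hf.continuous_deriv (by simp)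
    have hV : ContinuousOn V (Icc R₁ R₂) := hVcont.mono fun r hr => hR₁.trans_le hr.1
    have hq : ∀ r ∈ Icc R₁ R₂, r ^ 2 + a ^ 2 ≠ 0 := fun r hr => by
      have : 0 < r := hrp.trans (hR₁.trans_le hr.1)
      positivity
    have hΔ0 : ∀ r ∈ Icc R₁ R₂, Δ r ≠ 0 := fun r hr => (hΔpos r (hR₁.trans_le hr.1)).ne'
    have hqc : ContinuousOn (fun r : ℝ => r ^ 2 + a ^ 2) (Icc R₁ R₂) := by fun_prop
    exact ((hΔcont.continuousOn.div hqc hq).mul (hd'.pow 2).continuousOn).add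
      (((hV.sub continuousOn_const).mul (hqc.div hΔcont.continuousOn hΔ0)).mul
        (hf.continuous.pow 2).continuousOn)
  have hgzero : ∀ r ∉ Ioo R₁ R₂, g r = 0 := by
    intro r hr
    have hrs : r ∉ tsupport f := fun h => hr (hfs h)
    have h1 : f r = 0 := image_eq_zero_of_notMem_tsupport hrs
    have h2 : deriv f r = 0 :=
      image_eq_zero_of_notMem_tsupport fun h => hrs (tsupport_deriv_subset h)
    simp [hg, h1, h2]
  have hred : ∫ r in Ioi rp, g r = ∫ r in R₁..R₂, g r := by
    rw [intervalIntegral.integral_of_le hR₂.le]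
    refine setIntegral_eq_of_subset_of_forall_sdiff_eq_zero measurableSet_Ioi
      (fun r hr => hR₁.trans hr.1) fun r hr => hgzero r fun h => hr.2 ⟨h.1, h.2.le⟩
  rw [hred]
  have hint : ∀ x ∈ Icc R₁ R₂, ∀ y ∈ Icc R₁ R₂, IntervalIntegrable g volume x y :=
    fun x hx y hy => (hgcont.mono (uIcc_subset_Icc hx hy)).intervalIntegrable
  have hpiece : ∀ C x y : ℝ, x ∈ Icc R₁ R₂ → y ∈ Icc R₁ R₂ → x ≤ y →
      (∀ r ∈ Ioo x y, g r ≤ C) → ∫ r in x..y, g r ≤ C * (y - x) := by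
    intro C x y hx hy hxy hC
    calc ∫ r in x..y, g r ≤ ∫ _ in x..y, C :=
          intervalIntegral.integral_mono_on_of_le_Ioo hxy (hint x hx y hy)
            intervalIntegrable_const hC
      _ = C * (y - x) := by simp [mul_comm]
  have hl : R₁ ∈ Icc R₁ R₂ := left_mem_Icc.2 hR₂.le
  have hr : R₂ ∈ Icc R₁ R₂ := right_mem_Icc.2 hR₂.le
  have hp : R₁ + L / 4 ∈ Icc R₁ R₂ := ⟨by linarith, by linarith⟩
  have hq : R₂ - L / 4 ∈ Icc R₁ R₂ := ⟨by linarith, by linarith⟩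
  have hbound' : ∀ r ∈ Ioo R₁ R₂, g r ≤ K₁ * L ^ 2 := fun r hr =>
    (hbound r hr).trans (sub_le_self _ (by positivity))
  have hleft := hpiece (K₁ * L ^ 2) R₁ (R₁ + L / 4) hl hp (by linarith)
    fun r h => hbound' r ⟨h.1, h.2.trans_le hp.2⟩
  have hright := hpiece (K₁ * L ^ 2) (R₂ - L / 4) R₂ hq hr (by linarith)
    fun r h => hbound' r ⟨hq.1.trans_lt h.1, h.2⟩
  have hmid := hpiece (K₁ * L ^ 2 - K₂ * (5 / 32 * L ^ 2) ^ 2) (R₁ + L / 4) (R₂ - L / 4) hp hq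
    (by linarith) fun r h => by
      have := hbound r ⟨hp.1.trans_lt h.1, h.2.trans_le hq.2⟩
      have : K₂ * (5 / 32 * L ^ 2) ^ 2 ≤ K₂ * f r ^ 2 := by
        have := hfl r ⟨h.1.le, h.2.le⟩
        gcongr
      linarith
  have hwidth : R₂ - L / 4 - (R₁ + L / 4) = L / 2 := by linarith
  rw [hwidth] at hmid
  rw [← intervalIntegral.integral_add_adjacent_intervals (hint _ hl _ hp) (hint _ hp _ hr),
    ← intervalIntegral.integral_add_adjacent_intervals (hint _ hp _ hq) (hint _ hq _ hr)]
  have hgain := mul_lt_mul_of_pos_right hK (pow_pos hLpos 3)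
  have := mul_pos hK₁pos (pow_pos hLpos 3)
  linarith
end

section
/- Let m∈ℤ and ω∈ℂ, and set ξ := i(Ξam − (r_+²+a²)ω)/Δ_-'(r_+). Let A, B:(r_+,∞)→ℝ be differentiable with A'(r) = ((r²+a²)(1+r²/ℓ²) − Δ_-(r))/(Δ_-(r)(1+r²/ℓ²)) and B'(r) = aΞ/Δ_-(r). Then the function r ↦ −i(ωA(r) − mB(r)) − ξ·log(r−r_+), defined on (r_+,∞), extends to a smooth function on [r_+,∞); equivalently, ρ(r) := exp( −ξ·log(r−r_+) )·exp( −i(ωA(r) − mB(r)) ) extends to a smooth nowhere-vanishing function on [r_+,∞). -/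
open Set

/-- A smooth function on a closed half-line has a smooth primitive there. -/
lemma exists_contDiffOn_primitive_Ici {f : ℝ → ℝ} {x₀ : ℝ}
    (hf : ContDiffOn ℝ (⊤ : ℕ∞) f (Ici x₀)) :
    ∃ h : ℝ → ℝ, ContDiffOn ℝ (⊤ : ℕ∞) h (Ici x₀) ∧ ∀ r ∈ Ici x₀, HasDerivAt h (f r) r := by
  have hcont : Continuous fun t => f (max x₀ t) :=
    hf.continuousOn.comp_continuous (by fun_prop) fun t => le_max_left x₀ t
  have hder : ∀ r ∈ Ici x₀, HasDerivAt (fun u => ∫ t in x₀..u, f (max x₀ t)) (f r) r := by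
    intro r hr
    have h := hcont.integral_hasStrictDerivAt x₀ r |>.hasDerivAt
    rwa [max_eq_right (mem_Ici.1 hr)] at h
  refine ⟨_, ?_, hder⟩
  rw [contDiffOn_infty_iff_derivWithin (uniqueDiffOn_Ici x₀)]
  refine ⟨fun r hr => (hder r hr).differentiableAt.differentiableWithinAt, hf.congr fun r hr => ?_⟩
  exact (hder r hr).hasDerivWithinAt.derivWithin (uniqueDiffOn_Ici x₀ r hr)

/-- A primitive of a rational function with a simple pole at `x₀` is, to the right of `x₀`, the
residue times a logarithm plus a function that is smooth up to `x₀`. -/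
lemma exists_contDiffOn_eq_residue_mul_log_add {P D : Polynomial ℝ} {x₀ : ℝ}
    (hroot : D.eval x₀ = 0) (hsimple : D.derivative.eval x₀ ≠ 0)
    (hD : ∀ r ∈ Ioi x₀, D.eval r ≠ 0) {F : ℝ → ℝ}
    (hF : ∀ r ∈ Ioi x₀, HasDerivAt F (P.eval r / D.eval r) r) :
    ∃ h : ℝ → ℝ, ContDiffOn ℝ (⊤ : ℕ∞) h (Ici x₀) ∧
      ∀ r ∈ Ioi x₀, F r = P.eval x₀ / D.derivative.eval x₀ * Real.log (r - x₀) + h r := by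
  obtain ⟨Q, rfl⟩ := Polynomial.dvd_iff_isRoot.2 hroot
  have hQx₀ : ((Polynomial.X - Polynomial.C x₀) * Q).derivative.eval x₀ = Q.eval x₀ := by simp
  rw [hQx₀] at hsimple ⊢
  set c := P.eval x₀ / Q.eval x₀ with hc
  obtain ⟨R, hR⟩ : Polynomial.X - Polynomial.C x₀ ∣ P - Polynomial.C c * Q := by
    rw [Polynomial.dvd_iff_isRoot]
    simp [hc, hsimple]
  have hQ : ∀ r ∈ Ici x₀, Q.eval r ≠ 0 := by
    intro r hr
    rcases eq_or_lt_of_le (mem_Ici.1 hr) with rfl | hlt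
    · exact hsimple
    · intro h
      exact hD r hlt (by simp [h])
  have hsmooth (S : Polynomial ℝ) : ContDiffOn ℝ (⊤ : ℕ∞) (fun r => S.eval r) (Ici x₀) := by
    simpa using (S.contDiff_aeval (𝕜 := ℝ) (⊤ : ℕ∞)).contDiffOn (s := Ici x₀)
  obtain ⟨H, hH, hH'⟩ := exists_contDiffOn_primitive_Ici ((hsmooth R).div (hsmooth Q) hQ)
  have hG : ∀ r ∈ Ioi x₀, HasDerivAt (fun r => F r - c * Real.log (r - x₀) - H r) 0 r := by
    intro r hr
    have hne : r - x₀ ≠ 0 := (sub_pos.2 hr).ne'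
    have hlog := (((hasDerivAt_id r).sub_const x₀).log hne).const_mul c
    refine (((hF r hr).sub hlog).sub (hH' r (mem_Ioi.1 hr).le)).congr_deriv ?_
    have hQr := hQ r (mem_Ioi.1 hr).le
    have hRr := congrArg (Polynomial.eval r) hR
    simp only [Polynomial.eval_sub, Polynomial.eval_mul, Polynomial.eval_C,
      Polynomial.eval_X, Pi.div_apply, id] at hRr ⊢
    field_simp
    linarith
  obtain ⟨k, hk⟩ := isOpen_Ioi.exists_is_const_of_deriv_eq_zero isPreconnected_Ioi
    (fun r hr => (hG r hr).differentiableAt.differentiableWithinAt) fun r hr => (hG r hr).deriv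
  refine ⟨fun r => H r + k, hH.add contDiffOn_const, fun r hr => ?_⟩
  have := hk r hr
  linarith

open Set
theorem stmt_19 (ℓ M a rp : ℝ) (hℓ : 0 < ℓ) (hM : 0 < M) (ha : |a| < ℓ) (hrp : 0 < rp)
    (Δ : ℝ → ℝ) (hΔ : ∀ r, Δ r = (r ^ 2 + a ^ 2) * (1 + r ^ 2 / ℓ ^ 2) - 2 * M * r)
    (hroot : Δ rp = 0) (hmax : ∀ r, Δ r = 0 → r ≤ rp) (hd : 0 < deriv Δ rp)
    (Ξ : ℝ) (hΞ : Ξ = 1 - a ^ 2 / ℓ ^ 2)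
    (m : ℤ) (ω : ℂ)
    (ξ : ℂ) (hξ : ξ = Complex.I *
      (((Ξ * a * (m : ℝ) : ℝ) : ℂ) - ((rp ^ 2 + a ^ 2 : ℝ) : ℂ) * ω)
      / ((deriv Δ rp : ℝ) : ℂ))
    (A B : ℝ → ℝ)
    (hA : ∀ r ∈ Ioi rp, HasDerivAt A
      (((r ^ 2 + a ^ 2) * (1 + r ^ 2 / ℓ ^ 2) - Δ r) / (Δ r * (1 + r ^ 2 / ℓ ^ 2))) r)
    (hB : ∀ r ∈ Ioi rp, HasDerivAt B (a * Ξ / Δ r) r) :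
    ∃ g : ℝ → ℂ, ContDiffOn ℝ (⊤ : ℕ∞) g (Ici rp) ∧ (∀ r ∈ Ici rp, g r ≠ 0) ∧
      ∀ r ∈ Ioi rp, g r =
        Complex.exp (-ξ * Complex.log ((r - rp : ℝ) : ℂ)) *
        Complex.exp (-Complex.I * (ω * ((A r : ℝ) : ℂ) - ((m : ℝ) : ℂ) * ((B r : ℝ) : ℂ))) := by
  have hw : ∀ r : ℝ, 0 < 1 + r ^ 2 / ℓ ^ 2 := fun r => by positivity
  have hΔ0 : ∀ r ∈ Ioi rp, Δ r ≠ 0 := fun r hr h => (hmax r h).not_gt hr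
  let W : Polynomial ℝ := 1 + .X ^ 2 * .C (ℓ ^ 2)⁻¹
  let D : Polynomial ℝ := (.X ^ 2 + .C (a ^ 2)) * W - .C (2 * M) * .X
  have hW : ∀ r, W.eval r = 1 + r ^ 2 / ℓ ^ 2 := fun r => by simp [W, div_eq_inv_mul]
  have hD : ∀ r, D.eval r = Δ r := fun r => by simp [D, hW, hΔ]
  have hD' : D.derivative.eval rp = deriv Δ rp := by
    rw [← Polynomial.deriv, funext hD]
  obtain ⟨hA₀, hA₀_smooth, hA_eq⟩ := exists_contDiffOn_eq_residue_mul_log_add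
    (P := .C (2 * M) * .X) (D := D * W) (x₀ := rp) (F := A) (by simp [hD, hroot])
    (by simpa [hD, hD', hroot, hW] using ⟨hd.ne', (hw rp).ne'⟩)
    (fun r hr => by simpa [hD, hW] using ⟨hΔ0 r hr, (hw r).ne'⟩)
    (fun r hr => by
      convert hA r hr using 1
      simp [hD, hW, hΔ])
  obtain ⟨hB₀, hB₀_smooth, hB_eq⟩ := exists_contDiffOn_eq_residue_mul_log_add
    (P := .C (a * Ξ)) (D := D) (x₀ := rp) (F := B) (by simp [hD, hroot])
    (by simpa [hD'] using hd.ne') (fun r hr => by simpa [hD] using hΔ0 r hr)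
    (fun r hr => by simpa [hD] using hB r hr)
  have hresA : (Polynomial.C (2 * M) * .X).eval rp / (D * W).derivative.eval rp =
      (rp ^ 2 + a ^ 2) / deriv Δ rp := by
    have h2M : 2 * M * rp = (rp ^ 2 + a ^ 2) * (1 + rp ^ 2 / ℓ ^ 2) := by
      linarith [hΔ rp]
    simp only [Polynomial.derivative_mul, Polynomial.eval_add, Polynomial.eval_mul, hD, hD', hroot,
      hW, Polynomial.eval_C, Polynomial.eval_X, zero_mul, add_zero, h2M]
    exact mul_div_mul_right _ _ (hw rp).ne'
  rw [hresA] at hA_eq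
  rw [hD', Polynomial.eval_C] at hB_eq
  refine ⟨fun r => Complex.exp (-Complex.I * (ω * ((hA₀ r : ℝ) : ℂ) -
    ((m : ℝ) : ℂ) * ((hB₀ r : ℝ) : ℂ))), ?_, fun r _ => Complex.exp_ne_zero _, fun r hr => ?_⟩
  · have hcast {f : ℝ → ℝ} (hf : ContDiffOn ℝ (⊤ : ℕ∞) f (Ici rp)) :
        ContDiffOn ℝ (⊤ : ℕ∞) (fun r => (f r : ℂ)) (Ici rp) :=
      Complex.ofRealCLM.contDiff.comp_contDiffOn hf
    exact (contDiffOn_const.mul ((contDiffOn_const.mul (hcast hA₀_smooth)).sub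
      (contDiffOn_const.mul (hcast hB₀_smooth)))).cexp
  · beta_reduce
    rw [← Complex.exp_add, hA_eq r hr, hB_eq r hr, hξ,
      ← Complex.ofReal_log (sub_pos.2 hr).le]
    congr 1
    have hd' : ((deriv Δ rp : ℝ) : ℂ) ≠ 0 := by exact_mod_cast hd.ne'
    push_cast
    field_simp
    ring
end
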